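/- Let F be a fact base, R a disjunctive rule, (R, h) a trigger on F, and let 𝒬 be the UCQ α_∨(F, R, h) (each produced fact base viewed as a CQ). Then there exists a disjunctive piece-unifier μ_∨ of 𝒬 with R such that F ⊨ β_∨(𝒬, R, μ_∨). -/

import Mathlib

/-! ## Basic syntax: terms, atoms, substitutions -/

/-- A term over variables `V` and constants `C`. -/
inductive FOTerm (V C : Type) where
  | var (v : V)
  | const (c : C)
deriving DecidableEq

/-- An atom `p(t_1,...,t_n)`. -/
structure FOAtom (P V C : Type) where
  pred : P
  args : List (FOTerm V C)
deriving DecidableEq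

/-- A substitution of variables by terms. -/
abbrev FOSubst (V C : Type) := V → FOTerm V C

variable {P V C : Type}

def FOTerm.applySub (u : FOSubst V C) : FOTerm V C → FOTerm V C
  | FOTerm.var v => u v
  | FOTerm.const c => FOTerm.const c

def FOAtom.applySub (u : FOSubst V C) (a : FOAtom P V C) : FOAtom P V C :=
  ⟨a.pred, a.args.map (FOTerm.applySub u)⟩

def applySubFS [DecidableEq P] [DecidableEq V] [DecidableEq C]
    (u : FOSubst V C) (S : Finset (FOAtom P V C)) : Finset (FOAtom P V C) :=
  S.image (FOAtom.applySub u)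

def FOTerm.varsOf [DecidableEq V] : FOTerm V C → Finset V
  | FOTerm.var v => {v}
  | FOTerm.const _ => ∅

def FOAtom.varsOf [DecidableEq V] (a : FOAtom P V C) : Finset V :=
  a.args.foldr (fun t acc => t.varsOf ∪ acc) ∅

/-- Variables occurring in a finite set of atoms. -/
def varsFS [DecidableEq V] (S : Finset (FOAtom P V C)) : Finset V :=
  S.sup FOAtom.varsOf

/-- Terms occurring in a finite set of atoms. -/
def termsFS [DecidableEq V] [DecidableEq C] (S : Finset (FOAtom P V C)) :
    Finset (FOTerm V C) :=
  S.sup (fun a => a.args.toFinset)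

/-- `h` is a homomorphism from the atom set `S₁` to the atom set `S₂`. -/
def IsHom (h : FOSubst V C) (S₁ S₂ : Finset (FOAtom P V C)) : Prop :=
  ∀ a ∈ S₁, a.applySub h ∈ S₂

/-- `S₂ ⊨ S₁` for atom sets viewed as existentially closed conjunctions:
there is a homomorphism from `S₁` to `S₂`. -/
def EntailsFS (S₂ S₁ : Finset (FOAtom P V C)) : Prop :=
  ∃ h : FOSubst V C, IsHom h S₁ S₂

/-! ## Disjunctive existential rules, triggers, chase step α -/

/-- A disjunctive existential rule `B → H₁ ∨ ... ∨ Hₙ`. -/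
structure DisjRule (P V C : Type) where
  body : Finset (FOAtom P V C)
  heads : List (Finset (FOAtom P V C))

/-- Well-formedness: non-empty body, at least one head disjunct, non-empty disjuncts. -/
def DisjRule.WF (R : DisjRule P V C) : Prop :=
  R.body.Nonempty ∧ R.heads ≠ [] ∧ ∀ H ∈ R.heads, H.Nonempty

/-- All variables of a rule. -/
def DisjRule.vars [DecidableEq V] (R : DisjRule P V C) : Finset V :=
  varsFS R.body ∪ R.heads.foldr (fun H acc => varsFS H ∪ acc) ∅

/-- A trigger `(R, h)` on `F`: `h` is a homomorphism from the body of `R` to `F`. -/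
def IsTrigger (R : DisjRule P V C) (h : FOSubst V C) (F : Finset (FOAtom P V C)) : Prop :=
  IsHom h R.body F

/-- `h'` is a safe extension of `h` for the head disjunct `H` of rule `R` w.r.t. the
fact base `F`: it agrees with `h` outside the existential variables of `H` and renames
the existential variables of `H` injectively to fresh variables. -/
def IsSafeExt [DecidableEq V] (F : Finset (FOAtom P V C)) (R : DisjRule P V C)
    (H : Finset (FOAtom P V C)) (h h' : FOSubst V C) : Prop :=
  (∀ v : V, v ∉ varsFS H \ varsFS R.body → h' v = h v) ∧
  (∀ v ∈ varsFS H \ varsFS R.body, ∃ w : V, h' v = FOTerm.var w ∧ w ∉ varsFS F) ∧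
  (∀ v ∈ varsFS H \ varsFS R.body, ∀ v' ∈ varsFS H \ varsFS R.body,
      h' v = h' v' → v = v')

/-- `L` is a result of the application `α_∨(F, R, h)` of the trigger `(R, h)` on `F`:
its `i`-th element is `F ∪ h^{safeᵢ}(Hᵢ)`. -/
def IsAlpha [DecidableEq P] [DecidableEq V] [DecidableEq C]
    (F : Finset (FOAtom P V C)) (R : DisjRule P V C) (h : FOSubst V C)
    (L : List (Finset (FOAtom P V C))) : Prop :=
  L.length = R.heads.length ∧
  ∀ (i : ℕ) (hi : i < L.length) (hi' : i < R.heads.length),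
    ∃ h' : FOSubst V C, IsSafeExt F R (R.heads.get ⟨i, hi'⟩) h h' ∧
      L.get ⟨i, hi⟩ = F ∪ applySubFS h' (R.heads.get ⟨i, hi'⟩)

/-! ## Partitions of terms (as equivalence relations), piece-unifiers -/

/-- A relation on terms, representing a partition of a set of terms (two terms are
related iff they belong to the same class). -/
abbrev TRel (V C : Type) := FOTerm V C → FOTerm V C → Prop

/-- Admissibility of a partition: no class contains two distinct constants. -/
def RelAdmissible (r : TRel V C) : Prop :=
  ∀ c c' : C, r (FOTerm.const c) (FOTerm.const c') → c = c'

/-- `u` is a substitution associated with the partition represented by `r`: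
it is constant on classes, maps each term to a member of its class (the selected term),
and gives priority to constants. -/
def IsAssocSub (r : TRel V C) (u : FOSubst V C) : Prop :=
  (∀ s t, r s t → s.applySub u = t.applySub u) ∧
  (∀ t, r t (t.applySub u)) ∧
  (∀ (v : V) (c : C), r (FOTerm.var v) (FOTerm.const c) → u v = FOTerm.const c)

/-- The data of a piece-unifier `(Q', H', P_u)`. -/
structure PieceUnif (P V C : Type) where
  Q' : Finset (FOAtom P V C)
  H' : Finset (FOAtom P V C)
  rel : TRel V C

/-- `μ` is a piece-unifier of the CQ `Q` with the conjunctive rule `B → H`. -/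
def IsPieceUnifier [DecidableEq P] [DecidableEq V] [DecidableEq C]
    (Q : Finset (FOAtom P V C)) (B H : Finset (FOAtom P V C))
    (μ : PieceUnif P V C) : Prop :=
  μ.Q'.Nonempty ∧ μ.Q' ⊆ Q ∧ μ.H' ⊆ H ∧
  Equivalence μ.rel ∧
  -- the partition is on the terms of Q' and H' (all other classes are singletons)
  (∀ s t, μ.rel s t → s = t ∨
      (s ∈ termsFS μ.Q' ∪ termsFS μ.H' ∧ t ∈ termsFS μ.Q' ∪ termsFS μ.H')) ∧
  RelAdmissible μ.rel ∧
  -- classes containing an existential variable of H' contain otherwise only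
  -- non-separating variables of Q'
  (∀ z ∈ varsFS μ.H' \ varsFS B, ∀ t, μ.rel (FOTerm.var z) t → t = FOTerm.var z ∨
      ∃ v : V, t = FOTerm.var v ∧ FOTerm.var v ∈ termsFS μ.Q' ∧ v ∉ varsFS (Q \ μ.Q')) ∧
  -- unification condition
  (∀ u : FOSubst V C, IsAssocSub μ.rel u → applySubFS u μ.Q' = applySubFS u μ.H')

/-- The join of a list of partitions (represented as relations): the equivalence
relation generated by their union. -/
def joinRel (rs : List (TRel V C)) : TRel V C :=
  Relation.EqvGen (fun s t => ∃ r ∈ rs, r s t)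

/-- The data of a disjunctive piece-unifier: the safe copies `Q₁, ..., Qₙ` together
with the conjunctive piece-unifiers `μ₁, ..., μₙ`. -/
structure DisjPieceUnif (P V C : Type) where
  Qs : List (Finset (FOAtom P V C))
  mus : List (PieceUnif P V C)

/-- The join of the partitions of a disjunctive piece-unifier. -/
def DisjPieceUnif.rel (μ : DisjPieceUnif P V C) : TRel V C :=
  joinRel (μ.mus.map PieceUnif.rel)

/-- `Qc` is a safe copy of `Q` (bijective renaming of its variables). -/
def IsSafeCopy [DecidableEq P] [DecidableEq V] [DecidableEq C]
    (Q Qc : Finset (FOAtom P V C)) : Prop :=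
  ∃ ρ : V → V, Function.Injective ρ ∧
    Qc = Q.image (FOAtom.applySub (fun v => FOTerm.var (ρ v)))

/-- `μ` is a disjunctive piece-unifier of the UCQ `𝒬` with the disjunctive rule `R`. -/
def IsDisjPieceUnifier [DecidableEq P] [DecidableEq V] [DecidableEq C]
    (𝒬 : Set (Finset (FOAtom P V C))) (R : DisjRule P V C)
    (μ : DisjPieceUnif P V C) : Prop :=
  μ.Qs.length = R.heads.length ∧ μ.mus.length = R.heads.length ∧
  -- each Qᵢ is a safe copy of a CQ of 𝒬, with variables disjoint from the rule
  -- and from the other copies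
  (∀ (i : ℕ) (hi : i < μ.Qs.length), ∃ Q ∈ 𝒬, IsSafeCopy Q (μ.Qs.get ⟨i, hi⟩)) ∧
  (∀ (i : ℕ) (hi : i < μ.Qs.length), Disjoint (varsFS (μ.Qs.get ⟨i, hi⟩)) R.vars) ∧
  (∀ (i j : ℕ) (hi : i < μ.Qs.length) (hj : j < μ.Qs.length), i ≠ j →
      Disjoint (varsFS (μ.Qs.get ⟨i, hi⟩)) (varsFS (μ.Qs.get ⟨j, hj⟩))) ∧
  -- each μᵢ is a piece-unifier of Qᵢ with B → Hᵢ
  (∀ (i : ℕ) (hi : i < R.heads.length) (hi1 : i < μ.Qs.length) (hi2 : i < μ.mus.length),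
      IsPieceUnifier (μ.Qs.get ⟨i, hi1⟩) R.body (R.heads.get ⟨i, hi⟩)
        (μ.mus.get ⟨i, hi2⟩)) ∧
  -- the join of the partitions is admissible
  RelAdmissible μ.rel

/-- `β_∨(𝒬, R, μ) = u(B) ∪ ⋃ᵢ u(Qᵢ ∖ Qᵢ')`, for `u` a substitution associated with
the join of the partitions of `μ`. -/
def betaRw [DecidableEq P] [DecidableEq V] [DecidableEq C]
    (R : DisjRule P V C) (μ : DisjPieceUnif P V C) (u : FOSubst V C) :
    Finset (FOAtom P V C) :=
  applySubFS u R.body ∪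
    (List.zipWith (fun Qi m => applySubFS u (Qi \ PieceUnif.Q' m)) μ.Qs μ.mus).foldr
      (· ∪ ·) ∅

/-! ## Semantics -/

/-- A first-order interpretation (with non-empty domain). -/
structure Interp (P V C : Type) where
  dom : Type
  nonempty : Nonempty dom
  rel : P → List dom → Prop
  cst : C → dom

def Interp.evalT (I : Interp P V C) (a : V → I.dom) : FOTerm V C → I.dom
  | FOTerm.var v => a v
  | FOTerm.const c => I.cst c

def Interp.satAtom (I : Interp P V C) (a : V → I.dom) (atm : FOAtom P V C) : Prop :=
  I.rel atm.pred (atm.args.map (I.evalT a))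

def Interp.satFS (I : Interp P V C) (a : V → I.dom) (S : Finset (FOAtom P V C)) : Prop :=
  ∀ atm ∈ S, I.satAtom a atm

/-- `I` is a model of the atom set `S` viewed as an existentially closed conjunction. -/
def Interp.modelsFB [DecidableEq V] (I : Interp P V C) (S : Finset (FOAtom P V C)) : Prop :=
  ∃ a : V → I.dom, I.satFS a S

/-- `I` satisfies the disjunctive existential rule `R`. -/
def Interp.satRule [DecidableEq V] (I : Interp P V C) (R : DisjRule P V C) : Prop :=
  ∀ a : V → I.dom, I.satFS a R.body →
    ∃ H ∈ R.heads, ∃ a' : V → I.dom,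
      (∀ v ∈ varsFS R.body, a' v = a v) ∧ I.satFS a' H

/-- First-order entailment `F, ℛ ⊨ 𝒬` of a UCQ from a fact base and a set of
disjunctive existential rules. -/
def SemEntails [DecidableEq V] (F : Finset (FOAtom P V C)) (ℛ : Set (DisjRule P V C))
    (𝒬 : Set (Finset (FOAtom P V C))) : Prop :=
  ∀ I : Interp P V C, I.modelsFB F → (∀ R ∈ ℛ, I.satRule R) →
    ∃ Q ∈ 𝒬, I.modelsFB Q

/-! ## Piece-rewriting -/

/-- `IsPieceRewriting ℛ 𝒬 𝒬'` holds when the UCQ `𝒬'` is obtained from the UCQ `𝒬`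
by a finite sequence of one-step piece-rewritings with rules of `ℛ`. -/
inductive IsPieceRewriting [DecidableEq P] [DecidableEq V] [DecidableEq C]
    (ℛ : Set (DisjRule P V C)) :
    Finset (Finset (FOAtom P V C)) → Finset (Finset (FOAtom P V C)) → Prop
  | refl (𝒬 : Finset (Finset (FOAtom P V C))) : IsPieceRewriting ℛ 𝒬 𝒬
  | step (𝒬 𝒬' : Finset (Finset (FOAtom P V C))) (R : DisjRule P V C)
      (μ : DisjPieceUnif P V C) (u : FOSubst V C) :
      IsPieceRewriting ℛ 𝒬 𝒬' → R ∈ ℛ →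
      IsDisjPieceUnifier (↑𝒬' : Set (Finset (FOAtom P V C))) R μ →
      IsAssocSub μ.rel u →
      IsPieceRewriting ℛ 𝒬 (insert (betaRw R μ u) 𝒬')

theorem mem_foldr_union {α : Type} [DecidableEq α] (l : List (Finset α)) (x : α) :
    x ∈ l.foldr (· ∪ ·) ∅ ↔ ∃ S ∈ l, x ∈ S := by
  induction l with
  | nil => simp
  | cons S l ih => simp [ih]

theorem FOAtom.mem_varsOf [DecidableEq V] (a : FOAtom P V C) (v : V) :
    v ∈ a.varsOf ↔ FOTerm.var v ∈ a.args := by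
  obtain ⟨p, l⟩ := a
  simp only [FOAtom.varsOf]
  induction l with
  | nil => simp
  | cons t l ih =>
    rw [List.foldr_cons, Finset.mem_union, ih, List.mem_cons]
    cases t <;> simp [FOTerm.varsOf]

theorem mem_varsFS [DecidableEq V] (S : Finset (FOAtom P V C)) (v : V) :
    v ∈ varsFS S ↔ ∃ a ∈ S, FOTerm.var v ∈ a.args := by
  simp [varsFS, Finset.mem_sup, FOAtom.mem_varsOf]

theorem mem_termsFS [DecidableEq V] [DecidableEq C] (S : Finset (FOAtom P V C))
    (t : FOTerm V C) : t ∈ termsFS S ↔ ∃ a ∈ S, t ∈ a.args := by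
  simp [termsFS, Finset.mem_sup]

theorem DisjRule.varsFS_body_subset_vars [DecidableEq V] (R : DisjRule P V C) :
    varsFS R.body ⊆ R.vars :=
  Finset.subset_union_left

theorem DisjRule.varsFS_head_subset_vars [DecidableEq V] (R : DisjRule P V C)
    {H : Finset (FOAtom P V C)} (hH : H ∈ R.heads) : varsFS H ⊆ R.vars := by
  refine Finset.Subset.trans ?_ Finset.subset_union_right
  generalize R.heads = l at hH ⊢
  induction l with
  | nil => simp at hH
  | cons K l ih =>
    rcases List.mem_cons.1 hH with rfl | hH
    · exact Finset.subset_union_left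
    · exact (ih hH).trans Finset.subset_union_right

theorem FOAtom.applySub_congr {u u' : FOSubst V C} {a : FOAtom P V C}
    (h : ∀ t ∈ a.args, t.applySub u = t.applySub u') : a.applySub u = a.applySub u' := by
  simp only [FOAtom.applySub, FOAtom.mk.injEq, true_and]
  exact List.map_congr_left h

/-- The substitution that applies `u` first and `k` second. -/
def FOSubst.comp (k u : FOSubst V C) : FOSubst V C := fun v => (u v).applySub k

theorem FOTerm.applySub_comp (k u : FOSubst V C) (t : FOTerm V C) :
    t.applySub (k.comp u) = (t.applySub u).applySub k := by
  cases t <;> rfl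

theorem FOAtom.applySub_comp (k u : FOSubst V C) (a : FOAtom P V C) :
    a.applySub (k.comp u) = (a.applySub u).applySub k := by
  simp [FOAtom.applySub, FOTerm.applySub_comp]

theorem FOTerm.applySub_var (t : FOTerm V C) : t.applySub FOTerm.var = t := by
  cases t <;> rfl

theorem FOAtom.applySub_var (a : FOAtom P V C) : a.applySub FOTerm.var = a := by
  obtain ⟨p, l⟩ := a
  simp [FOAtom.applySub, funext FOTerm.applySub_var]

/-- A variable renaming seen as a substitution. -/
def renameSub (ρ : V → V) : FOSubst V C := fun v => FOTerm.var (ρ v)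

theorem mem_termsFS_applySubFS [DecidableEq P] [DecidableEq V] [DecidableEq C]
    (u : FOSubst V C) (S : Finset (FOAtom P V C)) (t : FOTerm V C) :
    t ∈ termsFS (applySubFS u S) ↔ ∃ s ∈ termsFS S, s.applySub u = t := by
  simp only [mem_termsFS, applySubFS, Finset.mem_image, FOAtom.applySub]
  constructor
  · rintro ⟨_, ⟨a, ha, rfl⟩, ht⟩
    obtain ⟨s, hs, rfl⟩ := List.mem_map.1 ht
    exact ⟨s, ⟨a, ha, hs⟩, rfl⟩
  · rintro ⟨s, ⟨a, ha, hs⟩, rfl⟩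
    exact ⟨_, ⟨a, ha, rfl⟩, List.mem_map.2 ⟨s, hs, rfl⟩⟩

theorem mem_varsFS_applySubFS_renameSub [DecidableEq P] [DecidableEq V] [DecidableEq C]
    (ρ : V → V) (S : Finset (FOAtom P V C)) (v : V) :
    v ∈ varsFS (applySubFS (renameSub ρ) S) ↔ ∃ w ∈ varsFS S, ρ w = v := by
  rw [mem_varsFS, ← mem_termsFS, mem_termsFS_applySubFS]
  constructor
  · rintro ⟨s, hs, h⟩
    cases s with
    | var w =>
      exact ⟨w, (mem_varsFS _ _).2 ((mem_termsFS _ _).1 hs), by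
        simpa [FOTerm.applySub, renameSub] using h⟩
    | const c => simp [FOTerm.applySub] at h
  · rintro ⟨w, hw, rfl⟩
    exact ⟨FOTerm.var w, (mem_termsFS _ _).2 ((mem_varsFS _ _).1 hw), rfl⟩

/-- An admissible partition has an associated substitution. -/
theorem exists_isAssocSub {r : TRel V C} (hr : Equivalence r) (hadm : RelAdmissible r) :
    ∃ u : FOSubst V C, IsAssocSub r u := by
  classical
  let S : Setoid (FOTerm V C) := ⟨r, hr⟩
  let u : FOSubst V C := fun v =>
    if hc : ∃ c, r (FOTerm.var v) (FOTerm.const c) then FOTerm.const hc.choose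
    else (Quotient.mk S (FOTerm.var v)).out
  have huc : ∀ v c, r (FOTerm.var v) (FOTerm.const c) → u v = FOTerm.const c := by
    intro v c hvc
    have hc : ∃ c, r (FOTerm.var v) (FOTerm.const c) := ⟨c, hvc⟩
    simp only [u, dif_pos hc]
    exact congrArg _ (hadm _ _ (hr.trans (hr.symm hc.choose_spec) hvc))
  refine ⟨u, ?_, ?_, huc⟩
  · intro s t hst
    cases s with
    | const c =>
      cases t with
      | const c' => simp [FOTerm.applySub, hadm _ _ hst]
      | var v => exact (huc v c (hr.symm hst)).symm
    | var v =>
      cases t with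
      | const c' => exact huc v c' hst
      | var w =>
        simp only [FOTerm.applySub]
        by_cases hc : ∃ c, r (FOTerm.var v) (FOTerm.const c)
        · obtain ⟨c, hc⟩ := hc
          rw [huc v c hc, huc w c (hr.trans (hr.symm hst) hc)]
        · have hc' : ¬ ∃ c, r (FOTerm.var w) (FOTerm.const c) :=
            fun ⟨c, h⟩ => hc ⟨c, hr.trans hst h⟩
          simp only [u, dif_neg hc, dif_neg hc']
          exact congrArg _ (Quotient.sound hst)
  · intro t
    cases t with
    | const c => exact hr.refl _
    | var v =>
      simp only [FOTerm.applySub]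
      by_cases hc : ∃ c, r (FOTerm.var v) (FOTerm.const c)
      · obtain ⟨c, hc⟩ := hc
        rw [huc v c hc]
        exact hc
      · simp only [u, dif_neg hc]
        exact hr.symm (Quotient.mk_out (s := S) (FOTerm.var v))

/-- Extend a labelling of the variables to terms; `Sum.inl` labels are terms of the fact
base and `Sum.inr` labels are existential variables of the rule. -/
def FOTerm.label (G : V → FOTerm V C ⊕ V) : FOTerm V C → FOTerm V C ⊕ V
  | FOTerm.var v => G v
  | FOTerm.const c => Sum.inl (FOTerm.const c)

/-- The partition of `T` into sets of terms with the same label. -/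
def labelRel (G : V → FOTerm V C ⊕ V) (T : Finset (FOTerm V C)) : TRel V C :=
  fun s t => s = t ∨ (s ∈ T ∧ t ∈ T) ∧ s.label G = t.label G

theorem labelRel.label_eq {G : V → FOTerm V C ⊕ V} {T : Finset (FOTerm V C)}
    {s t : FOTerm V C} (h : labelRel G T s t) : s.label G = t.label G := by
  rcases h with rfl | h
  · rfl
  · exact h.2

theorem labelRel_equivalence (G : V → FOTerm V C ⊕ V) (T : Finset (FOTerm V C)) :
    Equivalence (labelRel G T) where
  refl _ := Or.inl rfl
  symm := by
    rintro s t (rfl | ⟨⟨hs, ht⟩, h⟩)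
    · exact Or.inl rfl
    · exact Or.inr ⟨⟨ht, hs⟩, h.symm⟩
  trans := by
    rintro s t w (rfl | ⟨⟨hs, ht⟩, h⟩) h'
    · exact h'
    · rcases h' with rfl | ⟨⟨-, hw⟩, h'⟩
      · exact Or.inr ⟨⟨hs, ht⟩, h⟩
      · exact Or.inr ⟨⟨hs, hw⟩, h.trans h'⟩

theorem relAdmissible_of_label_eq {r : TRel V C} (G : V → FOTerm V C ⊕ V)
    (h : ∀ s t, r s t → s.label G = t.label G) : RelAdmissible r := by
  intro c c' hc
  simpa [FOTerm.label] using h _ _ hc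

/-- The candidate piece-unifier that unifies the copy of the atoms produced from the head
`H` by `h'` with `H` itself. -/
def labelUnif [DecidableEq P] [DecidableEq V] [DecidableEq C]
    (G : V → FOTerm V C ⊕ V) (ρ : V → V) (h' : FOSubst V C) (H : Finset (FOAtom P V C)) :
    PieceUnif P V C where
  Q' := applySubFS (renameSub ρ) (applySubFS h' H)
  H' := H
  rel := labelRel G (termsFS (applySubFS (renameSub ρ) (applySubFS h' H)) ∪ termsFS H)

theorem mem_of_mem_copy_sdiff [DecidableEq P] [DecidableEq V] [DecidableEq C]
    {ρ : V → V} {F S : Finset (FOAtom P V C)} {a : FOAtom P V C}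
    (ha : a ∈ applySubFS (renameSub ρ) (F ∪ S) \ applySubFS (renameSub ρ) S) :
    a ∈ applySubFS (renameSub ρ) F := by
  rw [applySubFS, Finset.image_union, Finset.mem_sdiff, Finset.mem_union] at ha
  exact ha.1.resolve_right ha.2

theorem isPieceUnifier_labelUnif [DecidableEq P] [DecidableEq V] [DecidableEq C]
    {G : V → FOTerm V C ⊕ V} {ρ : V → V} (hρ : Function.Injective ρ) {h h' : FOSubst V C}
    {F H : Finset (FOAtom P V C)} {R : DisjRule P V C} (hH : H.Nonempty)
    (hext : IsSafeExt F R H h h')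
    (hbody : ∀ v ∈ varsFS R.body, G v = Sum.inl (h v))
    (hex : ∀ v ∈ varsFS H \ varsFS R.body, G v = Sum.inr v)
    (hcopy : ∀ t ∈ termsFS H,
      ((t.applySub h').applySub (renameSub ρ)).label G = t.label G) :
    IsPieceUnifier (applySubFS (renameSub ρ) (F ∪ applySubFS h' H)) R.body H
      (labelUnif G ρ h' H) := by
  have hexLabel : ∀ z ∈ varsFS H \ varsFS R.body, ∀ t ∈ termsFS H,
      (FOTerm.var z).label G = t.label G → t = FOTerm.var z := by
    intro z hz t ht hzt
    cases t with
    | const c => simp [FOTerm.label, hex z hz] at hzt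
    | var v =>
      have hv : v ∈ varsFS H := (mem_varsFS _ _).2 ((mem_termsFS _ _).1 ht)
      by_cases hvB : v ∈ varsFS R.body
      · simp [FOTerm.label, hex z hz, hbody v hvB] at hzt
      · simp only [FOTerm.label, hex z hz, hex v (Finset.mem_sdiff.2 ⟨hv, hvB⟩),
          Sum.inr.injEq] at hzt
        rw [hzt]
  refine ⟨(hH.image _).image _, ?_, Finset.Subset.refl _, labelRel_equivalence _ _, ?_,
    relAdmissible_of_label_eq G fun _ _ => labelRel.label_eq, ?_, ?_⟩
  · exact Finset.image_subset_image Finset.subset_union_right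
  · rintro s t (rfl | ⟨h, -⟩)
    · exact Or.inl rfl
    · exact Or.inr h
  · intro z hz t hzt
    rcases hzt with rfl | ⟨⟨-, ht⟩, hzt⟩
    · exact Or.inl rfl
    rcases Finset.mem_union.1 ht with htQ | htH
    · right
      obtain ⟨t', ht', rfl⟩ := (mem_termsFS_applySubFS _ _ _).1 htQ
      obtain ⟨s, hs, rfl⟩ := (mem_termsFS_applySubFS _ _ _).1 ht'
      obtain rfl := hexLabel z hz s hs (hzt.trans (hcopy s hs))
      obtain ⟨w, hw, hwF⟩ := hext.2.1 z hz
      have heq : ((FOTerm.var z).applySub h').applySub (renameSub ρ)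
          = (FOTerm.var (ρ w) : FOTerm V C) := by
        simp [FOTerm.applySub, hw, renameSub]
      rw [heq] at htQ
      refine ⟨ρ w, heq, htQ, fun hmem => hwF ?_⟩
      obtain ⟨a, ha, hwa⟩ := (mem_varsFS _ _).1 hmem
      obtain ⟨w', hw', hww'⟩ := (mem_varsFS_applySubFS_renameSub ρ F (ρ w)).1
        ((mem_varsFS _ _).2 ⟨a, mem_of_mem_copy_sdiff ha, hwa⟩)
      exact hρ hww' ▸ hw'
    · exact Or.inl (hexLabel z hz t htH hzt)
  · intro u hu
    simp only [labelUnif, applySubFS, Finset.image_image]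
    refine Finset.image_congr fun a ha => ?_
    simp only [Function.comp_apply, ← FOAtom.applySub_comp]
    refine FOAtom.applySub_congr fun t hta => ?_
    have htH : t ∈ termsFS H := (mem_termsFS _ _).2 ⟨a, ha, hta⟩
    rw [FOTerm.applySub_comp, FOTerm.applySub_comp]
    refine hu.1 _ _ (Or.inr ⟨⟨Finset.mem_union_left _ ?_, Finset.mem_union_right _ htH⟩,
      hcopy t htH⟩)
    exact (mem_termsFS_applySubFS _ _ _).2
      ⟨_, (mem_termsFS_applySubFS _ _ _).2 ⟨t, htH, rfl⟩, rfl⟩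

/-- Finitely many pairwise disjoint copies of an infinite type fit in the complement of a
finite set. -/
theorem exists_disjoint_copies (V : Type) [Infinite V] (S : Finset V) (n : ℕ) :
    ∃ e : Fin n × V → V, Function.Injective e ∧ ∀ p, e p ∉ S := by
  have hcompl : Cardinal.mk ((S : Set V)ᶜ : Set V) = Cardinal.mk V :=
    Cardinal.mk_compl_finset_of_infinite S
  have hle : Cardinal.mk (Fin n × V) ≤ Cardinal.mk ((S : Set V)ᶜ : Set V) := by
    rw [hcompl, Cardinal.mk_prod, Cardinal.lift_id, Cardinal.lift_id]
    refine Cardinal.mul_le_of_le (Cardinal.aleph0_le_mk V) ?_ le_rfl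
    exact (Cardinal.mk_le_aleph0).trans (Cardinal.aleph0_le_mk V)
  obtain ⟨f⟩ := hle
  exact ⟨fun p => (f p).1, fun p q h => f.injective (Subtype.ext h), fun p => (f p).2⟩

/-- A labelling of the variables of the rule and of the copies of the produced fact bases
under which every head has the same labels as the atoms it produces. -/
theorem exists_labelling [DecidableEq V] {n : ℕ} {e : Fin n × V → V}
    (he : Function.Injective e) {F : Finset (FOAtom P V C)} {R : DisjRule P V C}
    (heR : ∀ p, e p ∉ R.vars) {h : FOSubst V C}
    {H : Fin n → Finset (FOAtom P V C)} (hH : ∀ i, H i ∈ R.heads)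
    {h' : Fin n → FOSubst V C} (hext : ∀ i, IsSafeExt F R (H i) h (h' i)) :
    ∃ G : V → FOTerm V C ⊕ V,
      (∀ v ∈ varsFS R.body, G v = Sum.inl (h v)) ∧
      (∀ i, ∀ v ∈ varsFS (H i) \ varsFS R.body, G v = Sum.inr v) ∧
      (∀ i, ∀ w ∈ varsFS F, G (e (i, w)) = Sum.inl (FOTerm.var w)) ∧
      (∀ i, ∀ v ∈ varsFS (H i) \ varsFS R.body, ∀ w, h' i v = FOTerm.var w →
        G (e (i, w)) = Sum.inr v) := by
  classical
  let K : Fin n × V → FOTerm V C ⊕ V := fun p =>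
    if hz : ∃ z ∈ varsFS (H p.1) \ varsFS R.body, h' p.1 z = FOTerm.var p.2 then
      Sum.inr hz.choose
    else Sum.inl (FOTerm.var p.2)
  let G : V → FOTerm V C ⊕ V :=
    Function.extend e K fun v => if v ∈ varsFS R.body then Sum.inl (h v) else Sum.inr v
  have hGR : ∀ v ∈ R.vars,
      G v = if v ∈ varsFS R.body then Sum.inl (h v) else Sum.inr v := fun v hv =>
    Function.extend_apply' _ _ _ fun ⟨p, hp⟩ => heR p (hp ▸ hv)
  have hGe : ∀ p, G (e p) = K p := fun p => he.extend_apply _ _ p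
  refine ⟨G, fun v hv => ?_, fun i v hv => ?_, fun i w hw => ?_, fun i v hv w hvw => ?_⟩
  · rw [hGR v (R.varsFS_body_subset_vars hv), if_pos hv]
  · rw [Finset.mem_sdiff] at hv
    rw [hGR v (R.varsFS_head_subset_vars (hH i) hv.1), if_neg hv.2]
  · rw [hGe]
    refine dif_neg ?_
    rintro ⟨z, hz, hzw⟩
    obtain ⟨w', hw', hw'F⟩ := (hext i).2.1 z hz
    obtain rfl : w' = w := by simpa using hw'.symm.trans hzw
    exact hw'F hw
  · have hz : ∃ z ∈ varsFS (H i) \ varsFS R.body, h' i z = FOTerm.var w := ⟨v, hv, hvw⟩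
    rw [hGe]
    refine (dif_pos hz).trans (congrArg _ ?_)
    exact (hext i).2.2 _ hz.choose_spec.1 _ hv (hz.choose_spec.2.trans hvw.symm)

theorem label_applySub_renameSub [DecidableEq V] [DecidableEq C] {ρ : V → V}
    {F H : Finset (FOAtom P V C)} {R : DisjRule P V C} {h h' : FOSubst V C}
    (htrig : IsTrigger R h F) (hext : IsSafeExt F R H h h') {G : V → FOTerm V C ⊕ V}
    (hbody : ∀ v ∈ varsFS R.body, G v = Sum.inl (h v))
    (hex : ∀ v ∈ varsFS H \ varsFS R.body, G v = Sum.inr v)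
    (hfact : ∀ w ∈ varsFS F, G (ρ w) = Sum.inl (FOTerm.var w))
    (hnew : ∀ v ∈ varsFS H \ varsFS R.body, ∀ w, h' v = FOTerm.var w →
      G (ρ w) = Sum.inr v)
    {t : FOTerm V C} (ht : t ∈ termsFS H) :
    ((t.applySub h').applySub (renameSub ρ)).label G = t.label G := by
  cases t with
  | const c => rfl
  | var v =>
    have hv : v ∈ varsFS H := (mem_varsFS _ _).2 ((mem_termsFS _ _).1 ht)
    by_cases hvB : v ∈ varsFS R.body
    · have hv' : h' v = h v := hext.1 v fun hmem => (Finset.mem_sdiff.1 hmem).2 hvB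
      simp only [FOTerm.applySub, FOTerm.label, hv', hbody v hvB]
      obtain ⟨a, ha, hva⟩ := (mem_varsFS _ _).1 hvB
      cases hhv : h v with
      | const c => rfl
      | var w =>
        refine hfact w ((mem_varsFS _ _).2 ⟨_, htrig a ha, ?_⟩)
        exact List.mem_map.2 ⟨_, hva, hhv⟩
    · have hvE : v ∈ varsFS H \ varsFS R.body := Finset.mem_sdiff.2 ⟨hv, hvB⟩
      obtain ⟨w, hw, -⟩ := hext.2.1 v hvE
      simp only [FOTerm.applySub, FOTerm.label, hw, hex v hvE, renameSub]
      exact hnew v hvE w hw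


/-- for any trigger `(R, h)` on `F`, viewing `𝒬 = α_∨(F, R, h)` as a UCQ,
there is a disjunctive piece-unifier `μ_∨` of `𝒬` with `R` such that
`F ⊨ β_∨(𝒬, R, μ_∨)`. -/
theorem stmt3 {P V C : Type} [DecidableEq P] [DecidableEq V] [DecidableEq C] [Infinite V]
    (F : Finset (FOAtom P V C)) (R : DisjRule P V C) (hWF : R.WF)
    (h : FOSubst V C) (htrig : IsTrigger R h F)
    (L : List (Finset (FOAtom P V C))) (hα : IsAlpha F R h L) :
    ∃ μ : DisjPieceUnif P V C,
      IsDisjPieceUnifier {Q | Q ∈ L} R μ ∧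
      ∃ u : FOSubst V C, IsAssocSub μ.rel u ∧ EntailsFS F (betaRw R μ u) := by
  obtain ⟨hlen, hα⟩ := hα
  obtain ⟨e, he, heR⟩ := exists_disjoint_copies V R.vars R.heads.length
  choose h' hext hL using fun i : Fin R.heads.length => hα i (i.2.trans_eq hlen.symm) i.2
  let H : Fin R.heads.length → Finset (FOAtom P V C) := R.heads.get
  have hH : ∀ i, H i ∈ R.heads := fun i => List.get_mem _ _
  obtain ⟨G, hbody, hex, hfact, hnew⟩ := exists_labelling he heR hH hext
  let ρ : Fin R.heads.length → V → V := fun i v => e (i, v)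
  have hρ : ∀ i, Function.Injective (ρ i) := fun i v w hvw => by simpa using he hvw
  let Q : Fin R.heads.length → Finset (FOAtom P V C) := fun i =>
    applySubFS (renameSub (ρ i)) (F ∪ applySubFS (h' i) (H i))
  have hQvars : ∀ i, ∀ v ∈ varsFS (Q i), ∃ w, e (i, w) = v := fun i v hv =>
    let ⟨w, _, hw⟩ := (mem_varsFS_applySubFS_renameSub _ _ _).1 hv
    ⟨w, hw⟩
  have hμ : ∀ i, IsPieceUnifier (Q i) R.body (H i) (labelUnif G (ρ i) (h' i) (H i)) :=
    fun i => isPieceUnifier_labelUnif (hρ i) (hWF.2.2 (H i) (hH i)) (hext i) hbody (hex i)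
      fun _ ht => label_applySub_renameSub htrig (hext i) hbody (hex i) (hfact i) (hnew i) ht
  let μ : DisjPieceUnif P V C :=
    ⟨List.ofFn Q, List.ofFn fun i => labelUnif G (ρ i) (h' i) (H i)⟩
  have hrel : ∀ s t, μ.rel s t → s.label G = t.label G := by
    intro s t hst
    induction hst with
    | rel s t hst =>
      obtain ⟨r, hr, hst⟩ := hst
      obtain ⟨m, hm, rfl⟩ := List.mem_map.1 hr
      obtain ⟨i, rfl⟩ := List.mem_ofFn.1 hm
      exact labelRel.label_eq hst
    | refl => rfl
    | symm _ _ _ ih => exact ih.symm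
    | trans _ _ _ _ _ ih₁ ih₂ => exact ih₁.trans ih₂
  have hadm : RelAdmissible μ.rel := relAdmissible_of_label_eq G hrel
  refine ⟨μ, ⟨List.length_ofFn, List.length_ofFn, ?_, ?_, ?_, ?_, hadm⟩, ?_⟩
  · intro i hi
    have hi' : i < R.heads.length := by simpa [μ] using hi
    refine ⟨L.get ⟨i, hi'.trans_eq hlen.symm⟩, List.get_mem _ _, ρ ⟨i, hi'⟩, hρ _, ?_⟩
    rw [hL ⟨i, hi'⟩]
    simp only [μ, List.get_ofFn]
    rfl
  · intro i hi
    simp only [μ, List.get_ofFn]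
    rw [Finset.disjoint_left]
    intro v hv
    obtain ⟨w, rfl⟩ := hQvars _ v hv
    exact heR _
  · intro i j hi hj hij
    simp only [μ, List.get_ofFn]
    rw [Finset.disjoint_left]
    intro v hv hv'
    obtain ⟨w, rfl⟩ := hQvars _ v hv
    obtain ⟨w', hw'⟩ := hQvars _ _ hv'
    have heq := congrArg Prod.fst (he hw')
    exact hij (by simpa using (congrArg Fin.val heq).symm)
  · intro i hi hi₁ hi₂
    simp only [μ, List.get_ofFn]
    exact hμ ⟨i, hi⟩
  · obtain ⟨u, hu⟩ := exists_isAssocSub (Relation.EqvGen.is_equivalence _) hadm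
    refine ⟨u, hu, fun v => (G v).elim id FOTerm.var, ?_⟩
    have hk : ∀ t : FOTerm V C,
        (t.applySub u).applySub (fun v => (G v).elim id FOTerm.var)
          = (t.label G).elim id FOTerm.var := by
      intro t
      rw [hrel _ _ (hu.2.1 t)]
      cases t.applySub u <;> rfl
    intro b hb
    rcases Finset.mem_union.1 hb with hb | hb
    · obtain ⟨a, ha, rfl⟩ := Finset.mem_image.1 hb
      rw [← FOAtom.applySub_comp, FOAtom.applySub_congr (u' := h)]
      · exact htrig a ha
      · intro t ht
        rw [FOTerm.applySub_comp, hk]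
        cases t with
        | const c => rfl
        | var v =>
          simp [FOTerm.label, FOTerm.applySub, hbody v ((mem_varsFS _ _).2 ⟨a, ha, ht⟩)]
    · obtain ⟨S, hS, hb⟩ := (mem_foldr_union _ _).1 hb
      obtain ⟨i, hi, rfl⟩ := List.mem_iff_getElem.1 hS
      have hi' : i < R.heads.length := by simpa [μ] using hi
      simp only [List.getElem_zipWith, μ, List.getElem_ofFn] at hb
      obtain ⟨a, ha, rfl⟩ := Finset.mem_image.1 hb
      obtain ⟨c, hc, rfl⟩ := Finset.mem_image.1 (mem_of_mem_copy_sdiff ha)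
      rw [← FOAtom.applySub_comp, ← FOAtom.applySub_comp,
        FOAtom.applySub_congr (u' := FOTerm.var), FOAtom.applySub_var]
      · exact hc
      · intro t ht
        rw [FOTerm.applySub_comp, FOTerm.applySub_comp, hk, FOTerm.applySub_var]
        cases t with
        | const c => rfl
        | var v =>
          have hv := hfact ⟨i, hi'⟩ v ((mem_varsFS _ _).2 ⟨c, hc, ht⟩)
          simp [FOTerm.label, FOTerm.applySub, renameSub, ρ, hv]
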